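/- arXiv:2309.02412 — 2 statements merged into one kernel-verified Lean document; each statement's English description precedes it below -/
import Mathlib

section
/- Suppose A1 holds and F = f + ψ. Let ε > 0, m ≥ 1 an integer, x₀ ∈ Q. Let σ ≥ 2⁴·(2/3)^{1/3}·m·L, and let B be a symmetric matrix with ‖B − ∇²f(x₀)‖ ≤ (2nL/3)·h where 0 < h ≤ [3⁴·σ^{3/2}·ε^{3/2} / (2^{14}·192·n³·L³)]^{1/3}. Set h_g = 3^{−1/3}·[ε·m/(σ·n^{1/2})]^{1/2}. Let x₁, …, x_m ∈ Q be such that for each t = 0, …, m−1: the vector g_t ∈ ℝⁿ satisfies ‖g_t − ∇f(x_t)‖ ≤ (√n·L/6)·h_g², and x_{t+1} satisfies M_{x_t,σ}(x_{t+1}) + ψ(x_{t+1}) ≤ F(x_t) and ‖∇M_{x_t,σ}(x_{t+1}) + ψ'(x_{t+1})‖ ≤ (σ/4)‖x_{t+1} − x_t‖² for some ψ'(x_{t+1}) ∈ ∂ψ(x_{t+1}), where in the model M_{x_t,σ} one takes g = g_t and the same matrix B for all t. Then either min_{1 ≤ t ≤ m} ‖∇f(x_t) + ψ'(x_t)‖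 ≤ ε, or F(x₀) − F(x_m) ≥ m·ε^{3/2} / (2·192·σ^{1/2}). -/
open RealInnerProductSpace

lemma aux_grad {E : Type*} [NormedAddCommGroup E] [InnerProductSpace ℝ E]
    (G : E → E) (L : ℝ) (hL : 0 ≤ L) (hG : Differentiable ℝ G)
    (hLip : ∀ u v : E, ‖fderiv ℝ G v - fderiv ℝ G u‖ ≤ L * ‖v - u‖) (x y : E) :
    ‖G y - G x - fderiv ℝ G x (y - x)‖ ≤ L * ‖y - x‖ ^ 2 := by
  have := Convex.norm_image_sub_le_of_norm_hasFDerivWithin_le' (𝕜 := ℝ) (f := G)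
    (f' := fun z => fderiv ℝ G z) (φ := fderiv ℝ G x) (s := segment ℝ x y)
    (C := L * ‖y - x‖) (x := x) (y := y)
    (fun z _ => (hG z).hasFDerivAt.hasFDerivWithinAt)
    (fun z hz => by
      refine (hLip x z).trans (mul_le_mul_of_nonneg_left ?_ hL)
      exact norm_sub_le_of_mem_segment hz)
    (convex_segment x y) (left_mem_segment ℝ x y) (right_mem_segment ℝ x y)
  nlinarith

lemma aux_val {E : Type*} [NormedAddCommGroup E] [InnerProductSpace ℝ E] [CompleteSpace E]
    (f : E → ℝ) (L : ℝ) (hL : 0 ≤ L) (hf : Differentiable ℝ f)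
    (hG : Differentiable ℝ (gradient f))
    (hLip : ∀ u v : E, ‖fderiv ℝ (gradient f) v - fderiv ℝ (gradient f) u‖ ≤ L * ‖v - u‖)
    (x s : E) :
    f (x + s) ≤ f x + ⟪gradient f x, s⟫ + 1 / 2 * ⟪fderiv ℝ (gradient f) x s, s⟫
      + L * ‖s‖ ^ 3 := by
  have hd : ∀ t : ℝ, HasDerivAt (fun t : ℝ => f (x + t • s) - t * ⟪gradient f x, s⟫
      - t ^ 2 / 2 * ⟪fderiv ℝ (gradient f) x s, s⟫)
      (⟪gradient f (x + t • s), s⟫ - ⟪gradient f x, s⟫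
        - t * ⟪fderiv ℝ (gradient f) x s, s⟫) t := by
    intro t
    have h1 : HasDerivAt (fun t : ℝ => x + t • s) s t := by
      simpa using ((hasDerivAt_id t).smul_const s).const_add x
    have h2 := (hf (x + t • s)).hasGradientAt.hasFDerivAt.comp_hasDerivAt t h1
    have h3 := (hasDerivAt_id t).mul_const ⟪gradient f x, s⟫
    have h4 := (((hasDerivAt_id t).pow 2).div_const 2).mul_const
      ⟪fderiv ℝ (gradient f) x s, s⟫
    have h5 := (h2.sub h3).sub h4
    refine h5.congr_deriv ?_
    rw [InnerProductSpace.toDual_apply_apply]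
    simp
  have := norm_image_sub_le_of_norm_deriv_le_segment' (a := (0:ℝ)) (b := 1) (C := L * ‖s‖ ^ 3)
    (fun t _ => (hd t).hasDerivWithinAt)
    (fun t ht => by
      have h1 := aux_grad (gradient f) L hL hG hLip x (x + t • s)
      have h2 : ⟪gradient f (x + t • s), s⟫ - ⟪gradient f x, s⟫
        - t * ⟪fderiv ℝ (gradient f) x s, s⟫ =
        ⟪gradient f (x + t • s) - gradient f x - fderiv ℝ (gradient f) x (x + t • s - x), s⟫ := by
        simp [inner_sub_left, inner_smul_left]
      rw [h2]
      refine (norm_inner_le_norm _ _).trans ?_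
      have h3 : ‖x + t • s - x‖ ^ 2 ≤ ‖s‖ ^ 2 := by
        have h0 : (0:ℝ) ≤ t := ht.1
        have h0' : t ≤ 1 := ht.2.le
        rw [add_sub_cancel_left, norm_smul, Real.norm_of_nonneg h0]
        have := norm_nonneg s
        gcongr
        nlinarith
      calc _ ≤ (L * ‖x + t • s - x‖ ^ 2) * ‖s‖ := by gcongr
        _ ≤ (L * ‖s‖ ^ 2) * ‖s‖ := by gcongr
        _ = _ := by ring) 1 (by simp)
  have h6 := (Real.le_norm_self _).trans this
  rw [one_smul, zero_smul, add_zero] at h6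
  linarith

lemma aux_num (ρ a l : ℝ) (hρ : 0 ≤ ρ) (ha : 0 ≤ a) (hl : l ≤ 3 / 40)
    (h : 1 ≤ (3 / 4 + l) * ρ ^ 2 + 1 / 150 + (1 / 50 + a) * ρ) :
    1 / 384 + 22 / 1000 * ρ ^ 3 - 60 * a ^ 3 ≤
      (1 / 6 - l) * ρ ^ 3 - 1 / 150 * ρ - 1 / 2 * (1 / 50 + a) * ρ ^ 2 := by
  have h3 : 0 ≤ ρ ^ 3 := by positivity
  have h2 : 0 ≤ ρ ^ 2 := by positivity
  have hl3 : l * ρ ^ 3 ≤ 3 / 40 * ρ ^ 3 := by gcongr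
  have hl2 : l * ρ ^ 2 ≤ 3 / 40 * ρ ^ 2 := by gcongr
  have hy : 1 / 2 * (a * ρ ^ 2) ≤ ρ ^ 3 / 50 + 50 * a ^ 3 := by
    nlinarith [mul_nonneg (add_nonneg hρ (mul_nonneg (by norm_num : (0:ℝ) ≤ 34) ha))
      (sq_nonneg (ρ - 17 * a)), pow_nonneg ha 3, mul_nonneg ha (sq_nonneg (ρ - 17 * a)),
      mul_nonneg hρ (sq_nonneg (ρ - 17 * a))]
  have ha3 : 0 ≤ a ^ 3 := by positivity
  suffices 1 / 384 + 1 / 150 * ρ + 1 / 100 * ρ ^ 2 ≤ 49 / 1000 * ρ ^ 3 + 10 * a ^ 3 by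
    nlinarith
  rcases le_total ρ (9 / 10) with hr | hr
  · have h1 : 3 / 10 ≤ a * ρ := by nlinarith
    have h4 : 1 / 3 ≤ a := by nlinarith
    have h5 : (1 / 3) ^ 3 ≤ a ^ 3 := by gcongr
    nlinarith
  · nlinarith [mul_nonneg hρ (mul_nonneg hρ (sub_nonneg.2 hr)), mul_nonneg hρ (sub_nonneg.2 hr)]

lemma aux_rpow (y : ℝ) (hy : 0 ≤ y) : y ^ ((3:ℝ) / 2) = Real.sqrt y ^ 3 := by
  rw [Real.sqrt_eq_rpow, ← Real.rpow_natCast, ← Real.rpow_mul hy]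
  norm_num

lemma aux_cbrt (y : ℝ) (hy : 0 ≤ y) : (y ^ ((1:ℝ) / 3)) ^ 3 = y := by
  rw [← Real.rpow_natCast, ← Real.rpow_mul hy]
  norm_num

/-- scaled version of the per-step inequality -/
lemma aux_scaled (s e r d L δ b p : ℝ) (hs : 0 < s) (he : 0 < e) (hr : 0 ≤ r) (hd : 0 ≤ d)
    (hL : 0 ≤ L) (hLs : L ≤ 3 / 40 * s ^ 2) (hδ : δ ≤ e ^ 2 / 150) (hb : b ≤ s * e / 50)
    (hgr : e ^ 2 ≤ (3 / 4 * s ^ 2 + L) * r ^ 2 + δ + (b + L * d) * r)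
    (hp : s ^ 2 / 6 * r ^ 3 - L * r ^ 3 - δ * r - 1 / 2 * (b + L * d) * r ^ 2 ≤ p) :
    e ^ 3 / s * (1 / 384) + 22 / 1000 * s ^ 2 * r ^ 3 - 60 * (L * d) ^ 3 / s ^ 4 ≤ p := by
  have key := aux_num (r * s / e) (L * d / (s * e)) (L / s ^ 2) (by positivity) (by positivity)
    (by rw [div_le_iff₀ (by positivity)]; exact hLs)
    (by
      have : e ^ 2 ≤ (3 / 4 * s ^ 2 + L) * r ^ 2 + e ^ 2 / 150 + (s * e / 50 + L * d) * r := by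
        nlinarith
      have h2 : (3 / 4 + L / s ^ 2) * (r * s / e) ^ 2 + 1 / 150
          + (1 / 50 + L * d / (s * e)) * (r * s / e) =
          ((3 / 4 * s ^ 2 + L) * r ^ 2 + e ^ 2 / 150 + (s * e / 50 + L * d) * r) / e ^ 2 := by
        field_simp
      rw [h2, le_div_iff₀ (by positivity)]
      linarith)
  have key2 := mul_le_mul_of_nonneg_left key (by positivity : 0 ≤ e ^ 3 / s)
  have e1 : e ^ 3 / s * (1 / 384 + 22 / 1000 * (r * s / e) ^ 3 - 60 * (L * d / (s * e)) ^ 3) =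
    e ^ 3 / s * (1 / 384) + 22 / 1000 * s ^ 2 * r ^ 3 - 60 * (L * d) ^ 3 / s ^ 4 := by
    field_simp
  have e2 : e ^ 3 / s * ((1 / 6 - L / s ^ 2) * (r * s / e) ^ 3 - 1 / 150 * (r * s / e)
      - 1 / 2 * (1 / 50 + L * d / (s * e)) * (r * s / e) ^ 2) =
      s ^ 2 / 6 * r ^ 3 - L * r ^ 3 - e ^ 2 / 150 * r
        - 1 / 2 * (s * e / 50 + L * d) * r ^ 2 := by
    field_simp
  rw [e1, e2] at key2
  have : δ * r ≤ e ^ 2 / 150 * r := by gcongr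
  have : b * r ^ 2 ≤ s * e / 50 * r ^ 2 := by gcongr
  linarith

set_option maxHeartbeats 1000000 in
/-- Lemma 9 of the paper: guarantee for a block of `m` inexact zeroth-order
cubic Newton steps with lazy finite-difference Hessian approximation and finite-difference
gradient approximations: either some iterate has (sub)gradient norm at most `ε`, or the block
makes functional progress at least `m·ε^{3/2}/(2·192·σ^{1/2})`. -/
theorem stmt_12 {n : ℕ} (hn : 1 ≤ n)
    (f ψ : EuclideanSpace ℝ (Fin n) → ℝ) (Q : Set (EuclideanSpace ℝ (Fin n)))
    (L : ℝ) (hL : 0 ≤ L)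
    (hf : ContDiff ℝ 2 f)
    (hLip : ∀ u v : EuclideanSpace ℝ (Fin n),
      ‖fderiv ℝ (gradient f) v - fderiv ℝ (gradient f) u‖ ≤ L * ‖v - u‖)
    (hQconv : Convex ℝ Q) (hψconv : ConvexOn ℝ Q ψ)
    (ε : ℝ) (hε : 0 < ε) (m : ℕ) (hm : 1 ≤ m)
    (x : ℕ → EuclideanSpace ℝ (Fin n)) (hxQ : ∀ t ≤ m, x t ∈ Q)
    (σ h hg : ℝ)
    (hσ : σ ≥ 2 ^ 4 * ((2 : ℝ) / 3) ^ ((1 : ℝ) / 3) * m * L)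
    (hh : 0 < h)
    (hhle : h ≤ (3 ^ 4 * σ ^ ((3 : ℝ) / 2) * ε ^ ((3 : ℝ) / 2)
      / (2 ^ 14 * 192 * (n : ℝ) ^ 3 * L ^ 3)) ^ ((1 : ℝ) / 3))
    (hgdef : hg = (3 : ℝ) ^ (-(1 : ℝ) / 3) * (ε * m / (σ * Real.sqrt n)) ^ ((1 : ℝ) / 2))
    (B : EuclideanSpace ℝ (Fin n) →L[ℝ] EuclideanSpace ℝ (Fin n))
    (hBsym : ∀ u v : EuclideanSpace ℝ (Fin n), ⟪B u, v⟫ = ⟪u, B v⟫)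
    (hB : ‖B - fderiv ℝ (gradient f) (x 0)‖ ≤ 2 * n * L / 3 * h)
    (g : ℕ → EuclideanSpace ℝ (Fin n))
    (hgapprox : ∀ t < m, ‖g t - gradient f (x t)‖ ≤ Real.sqrt n * L / 6 * hg ^ 2)
    (ψ' : ℕ → EuclideanSpace ℝ (Fin n))
    (hψ' : ∀ t < m, ∀ y : EuclideanSpace ℝ (Fin n),
      ψ (x (t + 1)) + ⟪ψ' (t + 1), y - x (t + 1)⟫ ≤ ψ y)
    (hdec : ∀ t < m,
      f (x t) + ⟪g t, x (t + 1) - x t⟫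
        + 1 / 2 * ⟪B (x (t + 1) - x t), x (t + 1) - x t⟫
        + σ / 6 * ‖x (t + 1) - x t‖ ^ 3 + ψ (x (t + 1)) ≤ f (x t) + ψ (x t))
    (hmodel : ∀ t < m,
      ‖g t + B (x (t + 1) - x t)
          + (σ / 2 * ‖x (t + 1) - x t‖) • (x (t + 1) - x t) + ψ' (t + 1)‖ ≤
        σ / 4 * ‖x (t + 1) - x t‖ ^ 2) :
    (∃ t, 1 ≤ t ∧ t ≤ m ∧ ‖gradient f (x t) + ψ' t‖ ≤ ε) ∨
      (f (x 0) + ψ (x 0)) - (f (x m) + ψ (x m)) ≥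
        m * ε ^ ((3 : ℝ) / 2) / (2 * 192 * Real.sqrt σ) := by
  classical
  have hm0 : (1:ℝ) ≤ m := by exact_mod_cast hm
  have hn0 : (1:ℝ) ≤ n := by exact_mod_cast hn
  have hLpos : 0 < L := by
    rcases hL.lt_or_eq with h1 | h1
    · exact h1
    · rw [← h1] at hhle
      norm_num at hhle
      linarith
  set c : ℝ := ((2 : ℝ) / 3) ^ ((1 : ℝ) / 3) with hc
  have hc3 : c ^ 3 = 2 / 3 := aux_cbrt _ (by norm_num)
  have hcpos : 0 < c := by positivity
  have hσpos : 0 < σ := lt_of_lt_of_le (by positivity) hσ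
  have hLm : (L * m) ^ 3 * 8192 ≤ 3 * σ ^ 3 := by
    have h1 : (2 ^ 4 * c * m * L) ^ 3 ≤ σ ^ 3 := by
      have : 0 ≤ 2 ^ 4 * c * m * L := by positivity
      gcongr
    have h2 : (2 ^ 4 * c * m * L) ^ 3 = 4096 * c ^ 3 * (L * m) ^ 3 := by ring
    rw [h2, hc3] at h1
    linarith
  have hLm' : L * m ≤ 3 / 40 * σ := by
    refine le_of_pow_le_pow_left₀ (n := 3) (by norm_num) (by positivity) ?_
    have : 0 < σ ^ 3 := by positivity
    nlinarith
  have hLσ : L ≤ 3 / 40 * σ := by nlinarith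
  obtain ⟨s, hs⟩ : ∃ s, s = Real.sqrt σ := ⟨_, rfl⟩
  obtain ⟨e, he⟩ : ∃ e, e = Real.sqrt ε := ⟨_, rfl⟩
  have hspos : 0 < s := hs ▸ Real.sqrt_pos.2 hσpos
  have hepos : 0 < e := he ▸ Real.sqrt_pos.2 hε
  have hs2 : s ^ 2 = σ := hs ▸ Real.sq_sqrt hσpos.le
  have he2 : e ^ 2 = ε := he ▸ Real.sq_sqrt hε.le
  have hb : 2 * n * L / 3 * h ≤ s * e / 50 := by
    have h1 : h ^ 3 ≤ 3 ^ 4 * s ^ 3 * e ^ 3 / (2 ^ 14 * 192 * (n : ℝ) ^ 3 * L ^ 3) := by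
      rw [aux_rpow σ hσpos.le, aux_rpow ε hε.le, ← hs, ← he] at hhle
      have h0 : 0 ≤ 3 ^ 4 * s ^ 3 * e ^ 3 / (2 ^ 14 * 192 * (n : ℝ) ^ 3 * L ^ 3) := by positivity
      rw [← aux_cbrt _ h0]
      gcongr
    rw [le_div_iff₀ (by positivity)] at h1
    have h2 : n * L * h ≤ 3 / 100 * (s * e) := by
      refine le_of_pow_le_pow_left₀ (n := 3) (by norm_num) (by positivity) ?_
      have : 0 < s ^ 3 * e ^ 3 := by positivity
      nlinarith
    linarith
  have hδ : Real.sqrt n * L / 6 * hg ^ 2 ≤ e ^ 2 / 150 := by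
    have hsn : 0 < Real.sqrt n := Real.sqrt_pos.2 (by linarith)
    have h3 : ((3:ℝ) ^ (-(1:ℝ) / 3)) ^ 2 ≤ 1 / 2 := by
      set k := (3:ℝ) ^ (-(1:ℝ) / 3) with hk
      have hkpos : 0 < k := by positivity
      have hk3 : k ^ 3 = 1 / 3 := by
        rw [hk, ← Real.rpow_natCast, ← Real.rpow_mul (by norm_num)]
        norm_num [Real.rpow_neg_one]
      have : k ≤ 7 / 10 := by
        refine le_of_pow_le_pow_left₀ (n := 3) (by norm_num) (by positivity) ?_
        rw [hk3]; norm_num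
      nlinarith
    have h4 : hg ^ 2 ≤ 1 / 2 * (ε * m / (σ * Real.sqrt n)) := by
      rw [hgdef, mul_pow, ← Real.sqrt_eq_rpow, Real.sq_sqrt (by positivity)]
      gcongr
    calc _ ≤ Real.sqrt n * L / 6 * (1 / 2 * (ε * m / (σ * Real.sqrt n))) := by gcongr
      _ = (L * m) * ε / (12 * σ) := by field_simp; norm_num
      _ ≤ (3 / 40 * σ) * ε / (12 * σ) := by gcongr
      _ = ε / 160 := by field_simp; norm_num
      _ ≤ _ := by rw [he2]; linarith
  have hfd : Differentiable ℝ f := hf.differentiable (by norm_num)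
  have hGd : Differentiable ℝ (gradient f) := by
    have h1 : ContDiff ℝ 1 (fderiv ℝ f) := hf.fderiv_right (by norm_num)
    have h2 := h1.differentiable (by norm_num)
    exact (InnerProductSpace.toDual ℝ (EuclideanSpace ℝ (Fin n))).symm.differentiable.comp h2
  rw [or_iff_not_imp_left]
  intro hno
  push Not at hno
  set r : ℕ → ℝ := fun t => ‖x (t + 1) - x t‖ with hr
  have hr0 : ∀ t, 0 ≤ r t := fun t => norm_nonneg _
  set d : ℝ := ∑ t ∈ Finset.range m, r t with hd
  have hd0 : 0 ≤ d := Finset.sum_nonneg fun t _ => hr0 t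
  have hdist : ∀ t ≤ m, ‖x t - x 0‖ ≤ d := by
    intro t ht
    rw [← Finset.sum_range_sub x t]
    refine (norm_sum_le _ _).trans ?_
    exact Finset.sum_le_sum_of_subset_of_nonneg (Finset.range_mono ht) fun i _ _ => hr0 i
  have step : ∀ t ∈ Finset.range m, e ^ 3 / s * (1 / 384) + 22 / 1000 * s ^ 2 * r t ^ 3
      - 60 * (L * d) ^ 3 / s ^ 4 ≤
      (f (x t) + ψ (x t)) - (f (x (t + 1)) + ψ (x (t + 1))) := by
    intro t ht
    rw [Finset.mem_range] at ht
    obtain ⟨v, hv⟩ : ∃ v, v = x (t + 1) - x t := ⟨_, rfl⟩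
    have hrv : r t = ‖v‖ := by rw [hv]
    have hdec' := hdec t ht
    have hmod := hmodel t ht
    have hga := hgapprox t ht
    have hnot := hno (t + 1) (by omega) (by omega)
    have hval := aux_val f L hL hfd hGd hLip (x t) v
    have hgrd := aux_grad (gradient f) L hL hGd hLip (x t) (x (t + 1))
    have hxv : x t + v = x (t + 1) := by rw [hv]; abel
    rw [hxv] at hval
    rw [← hv] at hdec' hmod hgrd
    have hBt : ‖B - fderiv ℝ (gradient f) (x t)‖ ≤ 2 * n * L / 3 * h + L * d := by
      have h1 := hLip (x t) (x 0)
      rw [norm_sub_rev (x 0)] at h1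
      have h2 : L * ‖x t - x 0‖ ≤ L * d := by gcongr; exact hdist t ht.le
      have h3 := norm_add_le (B - fderiv ℝ (gradient f) (x 0))
        (fderiv ℝ (gradient f) (x 0) - fderiv ℝ (gradient f) (x t))
      rw [sub_add_sub_cancel] at h3
      linarith
    have hBv : ‖B v - fderiv ℝ (gradient f) (x t) v‖ ≤ (2 * n * L / 3 * h + L * d) * ‖v‖ := by
      have h1 := (B - fderiv ℝ (gradient f) (x t)).le_opNorm v
      rw [sub_apply] at h1
      exact h1.trans (by gcongr)
    refine aux_scaled s e (r t) d L _ _ _ hspos hepos (hr0 t) hd0 hL (by rw [hs2]; exact hLσ)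
      hδ hb ?_ ?_
    · rw [he2, hs2, hrv]
      have h1 : gradient f (x (t + 1)) + ψ' (t + 1) =
          (gradient f (x (t + 1)) - gradient f (x t) - fderiv ℝ (gradient f) (x t) v)
          - (g t - gradient f (x t)) - (B v - fderiv ℝ (gradient f) (x t) v)
          - (σ / 2 * ‖v‖) • v
          + (g t + B v + (σ / 2 * ‖v‖) • v + ψ' (t + 1)) := by abel
      have h2 : ‖(σ / 2 * ‖v‖) • v‖ = σ / 2 * ‖v‖ ^ 2 := by
        rw [norm_smul, Real.norm_of_nonneg (by positivity)]; ring
      have h3 : ∀ a b c d e : EuclideanSpace ℝ (Fin n),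
          ‖a - b - c - d + e‖ ≤ ‖a‖ + ‖b‖ + ‖c‖ + ‖d‖ + ‖e‖ := by
        intro a b c d e
        have i1 := norm_add_le (a - b - c - d) e
        have i2 := norm_sub_le (a - b - c) d
        have i3 := norm_sub_le (a - b) c
        have i4 := norm_sub_le a b
        linarith
      rw [h1] at hnot
      have h4 := hnot.trans_le (h3 _ _ _ _ _)
      rw [h2] at h4
      linarith
    · rw [hs2, hrv]
      have h1 : -(Real.sqrt n * L / 6 * hg ^ 2 * ‖v‖) ≤ ⟪g t, v⟫ - ⟪gradient f (x t), v⟫ := by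
        rw [← inner_sub_left]
        have i1 := abs_le.1 (abs_real_inner_le_norm (g t - gradient f (x t)) v)
        have i2 : ‖g t - gradient f (x t)‖ * ‖v‖ ≤ Real.sqrt n * L / 6 * hg ^ 2 * ‖v‖ := by
          gcongr
        linarith [i1.1]
      have h2 : -((2 * n * L / 3 * h + L * d) * ‖v‖ ^ 2) ≤
          ⟪B v, v⟫ - ⟪fderiv ℝ (gradient f) (x t) v, v⟫ := by
        rw [← inner_sub_left]
        have i1 := abs_le.1 (abs_real_inner_le_norm (B v - fderiv ℝ (gradient f) (x t) v) v)
        have i2 : ‖B v - fderiv ℝ (gradient f) (x t) v‖ * ‖v‖ ≤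
          (2 * n * L / 3 * h + L * d) * ‖v‖ * ‖v‖ := by gcongr
        linarith [i1.1]
      linarith
  have hsum := Finset.sum_le_sum step
  rw [Finset.sum_range_sub' (fun t => f (x t) + ψ (x t)), Finset.sum_sub_distrib,
    Finset.sum_add_distrib, ← Finset.mul_sum] at hsum
  simp only [Finset.sum_const, Finset.card_range, nsmul_eq_mul] at hsum
  have hd3 : d ^ 3 ≤ m ^ 2 * ∑ t ∈ Finset.range m, r t ^ 3 := by
    have h1 := pow_sum_div_card_le_sum_pow (s := Finset.range m) (f := r)
      (fun t _ => hr0 t) 2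
    rw [Finset.card_range, div_le_iff₀ (by positivity)] at h1
    norm_num at h1
    linarith
  have hfin : m * (60 * (L * d) ^ 3 / s ^ 4) ≤
      22 / 1000 * s ^ 2 * ∑ t ∈ Finset.range m, r t ^ 3 := by
    set S := ∑ t ∈ Finset.range m, r t ^ 3 with hS
    have hS0 : 0 ≤ S := Finset.sum_nonneg fun t _ => pow_nonneg (hr0 t) 3
    rw [← mul_div_assoc, div_le_iff₀ (by positivity)]
    have h1 : m * L ^ 3 * d ^ 3 ≤ m * L ^ 3 * (m ^ 2 * S) := by gcongr
    have h2 : (L * m) ^ 3 * 8192 * S ≤ 3 * σ ^ 3 * S := by gcongr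
    have h3 : 0 ≤ σ ^ 3 * S := by positivity
    have h4 : 22 / 1000 * s ^ 2 * S * s ^ 4 = 22 / 1000 * (σ ^ 3 * S) := by rw [← hs2]; ring
    rw [h4]
    linarith
  have hgoal : m * ε ^ ((3 : ℝ) / 2) / (2 * 192 * Real.sqrt σ) = m * (e ^ 3 / s * (1 / 384)) := by
    rw [aux_rpow ε hε.le, ← hs, ← he]
    field_simp
    norm_num
  rw [hgoal]
  have hms : ∑ t ∈ Finset.range m, 22 / 1000 * s ^ 2 * r t ^ 3 =
      22 / 1000 * s ^ 2 * ∑ t ∈ Finset.range m, r t ^ 3 := (Finset.mul_sum _ _ _).symm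
  rw [hms] at hsum
  linarith
end

section
/- Let σ ≥ 2L, x ∈ Q, z ∈ ℝⁿ, and let x⁺ ∈ Q satisfy the model-decrease condition M_{x,σ}(x⁺) + ψ(x⁺) ≤ F(x). Suppose ‖g − ∇f(x)‖ ≤ δ_g and ‖B − ∇²f(z)‖ ≤ δ_B for some δ_g, δ_B ≥ 0. Then, with r := ‖x⁺ − x‖, one has F(x) − F(x⁺) ≥ (σ/24)·r³ − (2⁹/(3σ²))·(δ_B³ + L³‖x − z‖³) − (2³/(3σ^{1/2}))·δ_g^{3/2}. -/
open RealInnerProductSpace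

lemma aux_young1 (a r σ : ℝ) (ha : 0 ≤ a) (hr : 0 ≤ r) (hσ : 0 < σ) :
    1 / 2 * a * r ^ 2 ≤ σ / 96 * r ^ 3 + 2 ^ 9 / (3 * σ ^ 2) * a ^ 3 := by
  have key : 0 ≤ (σ * r - 32 * a) ^ 2 * (σ * r + 16 * a) := by positivity
  have e : σ / 96 * r ^ 3 + 2 ^ 9 / (3 * σ ^ 2) * a ^ 3 - 1 / 2 * a * r ^ 2
      = (σ * r - 32 * a) ^ 2 * (σ * r + 16 * a) / (96 * σ ^ 2) := by
    field_simp
    ring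
  have : 0 ≤ (σ * r - 32 * a) ^ 2 * (σ * r + 16 * a) / (96 * σ ^ 2) := by positivity
  linarith

lemma aux_young2 (d r σ : ℝ) (hd : 0 ≤ d) (hr : 0 ≤ r) (hσ : 0 < σ) :
    d * r ≤ σ / 48 * r ^ 3 + 2 ^ 3 / (3 * Real.sqrt σ) * d ^ ((3 : ℝ) / 2) := by
  have hs : 0 < Real.sqrt σ := Real.sqrt_pos.mpr hσ
  have hσe : σ = Real.sqrt σ ^ 2 := (Real.sq_sqrt hσ.le).symm
  have hp : d ^ ((3 : ℝ) / 2) = Real.sqrt d ^ 3 := by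
    rw [Real.sqrt_eq_rpow, ← Real.rpow_natCast, ← Real.rpow_mul hd]
    norm_num
  have hde : d = Real.sqrt d ^ 2 := (Real.sq_sqrt hd).symm
  have hq : 0 ≤ Real.sqrt d := Real.sqrt_nonneg d
  rw [hp]
  generalize Real.sqrt σ = s at *
  generalize Real.sqrt d = q at *
  subst hσe hde
  have e : s ^ 2 / 48 * r ^ 3 + 2 ^ 3 / (3 * s) * q ^ 3 - q ^ 2 * r
      = (s * r - 4 * q) ^ 2 * (s * r + 8 * q) / (48 * s) := by
    field_simp
    ring
  have : 0 ≤ (s * r - 4 * q) ^ 2 * (s * r + 8 * q) / (48 * s) := by positivity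
  linarith

lemma aux_inner {E : Type*} [NormedAddCommGroup E] [InnerProductSpace ℝ E]
    (A : E →L[ℝ] E) (h : E) (c : ℝ) (hA : ‖A‖ ≤ c) : |⟪A h, h⟫| ≤ c * ‖h‖ ^ 2 := by
  have h1 := abs_real_inner_le_norm (A h) h
  have h2 := A.le_of_opNorm_le hA h
  have h3 := mul_le_mul_of_nonneg_right h2 (norm_nonneg h)
  nlinarith

lemma aux_taylor {E : Type*} [NormedAddCommGroup E] [InnerProductSpace ℝ E] [CompleteSpace E]
    (f : E → ℝ) (L : ℝ) (hf : ContDiff ℝ 2 f)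
    (hLip : ∀ u v : E, ‖fderiv ℝ (gradient f) v - fderiv ℝ (gradient f) u‖ ≤ L * ‖v - u‖)
    (x h : E) :
    f (x + h) ≤ f x + ⟪gradient f x, h⟫ + 1 / 2 * ⟪fderiv ℝ (gradient f) x h, h⟫
      + L / 6 * ‖h‖ ^ 3 := by
  have hdf : Differentiable ℝ f := hf.differentiable (by norm_num)
  have hdg : Differentiable ℝ (gradient f) := by
    have h1 : ContDiff ℝ 1 (fderiv ℝ f) := hf.fderiv_right (by norm_num)
    have h2 : Differentiable ℝ (fderiv ℝ f) := h1.differentiable (by norm_num)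
    exact (InnerProductSpace.toDual ℝ E).symm.differentiable.comp h2
  have hline : ∀ t : ℝ, HasDerivAt (fun t : ℝ => x + t • h) h t := by
    intro t
    simpa using ((hasDerivAt_id t).smul_const h).const_add x
  have d1 : ∀ t : ℝ, HasDerivAt (fun t : ℝ => f (x + t • h)) ⟪gradient f (x + t • h), h⟫ t := by
    intro t
    have := (hdf (x + t • h)).hasFDerivAt.comp_hasDerivAt t (hline t)
    refine HasDerivAt.congr_deriv this ?_
    simp
  have d2 : ∀ t : ℝ, HasDerivAt (fun t : ℝ => ⟪gradient f (x + t • h), h⟫)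
      ⟪fderiv ℝ (gradient f) (x + t • h) h, h⟫ t := by
    intro t
    have := (hdg (x + t • h)).hasFDerivAt.comp_hasDerivAt t (hline t)
    simpa using this.inner ℝ (hasDerivAt_const t h)
  set a := ⟪gradient f x, h⟫ with ha
  set b := ⟪fderiv ℝ (gradient f) x h, h⟫ with hb
  have e1 : ∀ t : ℝ, HasDerivAt (fun t : ℝ => a + t * b + L / 2 * t ^ 2 * ‖h‖ ^ 3
      - ⟪gradient f (x + t • h), h⟫)
      (b + L * t * ‖h‖ ^ 3 - ⟪fderiv ℝ (gradient f) (x + t • h) h, h⟫) t := by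
    intro t
    have := ((((hasDerivAt_id t).mul_const b).const_add a).add
      ((((hasDerivAt_id t).pow 2).const_mul (L / 2)).mul_const (‖h‖ ^ 3))).sub (d2 t)
    refine HasDerivAt.congr_deriv this ?_
    norm_num [-mul_eq_mul_right_iff, -add_right_inj, -sub_left_inj, -add_left_inj]
    ring
  have e0 : ∀ t : ℝ, HasDerivAt (fun t : ℝ => f x + t * a + t ^ 2 * (b / 2)
      + L / 6 * t ^ 3 * ‖h‖ ^ 3 - f (x + t • h))
      (a + t * b + L / 2 * t ^ 2 * ‖h‖ ^ 3 - ⟪gradient f (x + t • h), h⟫) t := by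
    intro t
    have := (((((hasDerivAt_id t).mul_const a).const_add (f x)).add
      (((hasDerivAt_id t).pow 2).mul_const (b / 2))).add
      ((((hasDerivAt_id t).pow 3).const_mul (L / 6)).mul_const (‖h‖ ^ 3))).sub (d1 t)
    refine HasDerivAt.congr_deriv this ?_
    norm_num [-mul_eq_mul_right_iff, -add_right_inj, -sub_left_inj, -add_left_inj]
    ring
  have m1 : MonotoneOn (fun t : ℝ => a + t * b + L / 2 * t ^ 2 * ‖h‖ ^ 3
      - ⟪gradient f (x + t • h), h⟫) (Set.Ici 0) := by
    apply monotoneOn_of_deriv_nonneg (convex_Ici 0)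
    · exact fun t _ => (e1 t).continuousAt.continuousWithinAt
    · exact fun t _ => (e1 t).differentiableAt.differentiableWithinAt
    · intro t ht
      rw [interior_Ici] at ht
      have ht : 0 < t := ht
      rw [(e1 t).deriv]
      have h1 := aux_inner _ h _ (hLip x (x + t • h))
      have h2 := (abs_le.mp h1).2
      rw [sub_apply, inner_sub_left, add_sub_cancel_left, norm_smul,
        Real.norm_of_nonneg ht.le] at h2
      nlinarith
  have m0 : MonotoneOn (fun t : ℝ => f x + t * a + t ^ 2 * (b / 2)
      + L / 6 * t ^ 3 * ‖h‖ ^ 3 - f (x + t • h)) (Set.Ici 0) := by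
    apply monotoneOn_of_deriv_nonneg (convex_Ici 0)
    · exact fun t _ => (e0 t).continuousAt.continuousWithinAt
    · exact fun t _ => (e0 t).differentiableAt.differentiableWithinAt
    · intro t ht
      rw [interior_Ici] at ht
      have ht : 0 < t := ht
      rw [(e0 t).deriv]
      have := m1 (Set.mem_Ici.mpr le_rfl) (Set.mem_Ici.mpr ht.le) ht.le
      simpa [ha] using this
  have := m0 (Set.mem_Ici.mpr le_rfl) (Set.mem_Ici.mpr zero_le_one) zero_le_one
  simp at this
  linarith

/-- inequality (3.15) in the proof of Theorem 1: refined functional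
progress of one inexact cubic Newton step satisfying the model-decrease condition. -/
theorem stmt_17 {n : ℕ} (hn : 1 ≤ n)
    (f ψ : EuclideanSpace ℝ (Fin n) → ℝ) (Q : Set (EuclideanSpace ℝ (Fin n)))
    (L : ℝ) (hL : 0 ≤ L)
    (hf : ContDiff ℝ 2 f)
    (hLip : ∀ u v : EuclideanSpace ℝ (Fin n),
      ‖fderiv ℝ (gradient f) v - fderiv ℝ (gradient f) u‖ ≤ L * ‖v - u‖)
    (hQconv : Convex ℝ Q) (hψconv : ConvexOn ℝ Q ψ)
    (x : EuclideanSpace ℝ (Fin n)) (hx : x ∈ Q) (z : EuclideanSpace ℝ (Fin n))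
    (σ δg δB : ℝ) (hσ : σ ≥ 2 * L) (hσ0 : 0 < σ) (hδg : 0 ≤ δg) (hδB : 0 ≤ δB)
    (g : EuclideanSpace ℝ (Fin n))
    (B : EuclideanSpace ℝ (Fin n) →L[ℝ] EuclideanSpace ℝ (Fin n))
    (hBsym : ∀ u v : EuclideanSpace ℝ (Fin n), ⟪B u, v⟫ = ⟪u, B v⟫)
    (xp : EuclideanSpace ℝ (Fin n)) (hxp : xp ∈ Q)
    (hdec : f x + ⟪g, xp - x⟫ + 1 / 2 * ⟪B (xp - x), xp - x⟫ + σ / 6 * ‖xp - x‖ ^ 3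
      + ψ xp ≤ f x + ψ x)
    (hg : ‖g - gradient f x‖ ≤ δg)
    (hB : ‖B - fderiv ℝ (gradient f) z‖ ≤ δB) :
    (f x + ψ x) - (f xp + ψ xp) ≥
      σ / 24 * ‖xp - x‖ ^ 3
        - 2 ^ 9 / (3 * σ ^ 2) * (δB ^ 3 + L ^ 3 * ‖x - z‖ ^ 3)
        - 2 ^ 3 / (3 * Real.sqrt σ) * δg ^ ((3 : ℝ) / 2) := by
  obtain ⟨h, rfl⟩ : ∃ h, xp = x + h := ⟨xp - x, by abel⟩
  rw [add_sub_cancel_left] at *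
  have hT := aux_taylor f L hf hLip x h
  have h1 : ⟪gradient f x, h⟫ - ⟪g, h⟫ ≤ δg * ‖h‖ := by
    have h2 := neg_le_of_abs_le (abs_real_inner_le_norm (g - gradient f x) h)
    rw [inner_sub_left] at h2
    nlinarith [mul_le_mul_of_nonneg_right hg (norm_nonneg h)]
  have h2 := (abs_le.mp (aux_inner _ h _ hB)).1
  have h3 := (abs_le.mp (aux_inner _ h _ (hLip z x))).2
  rw [sub_apply, inner_sub_left] at h2 h3
  have y1 := aux_young1 δB ‖h‖ σ hδB (norm_nonneg h) hσ0
  have y2 := aux_young1 (L * ‖x - z‖) ‖h‖ σ (by positivity) (norm_nonneg h) hσ0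
  have y3 := aux_young2 δg ‖h‖ σ hδg (norm_nonneg h) hσ0
  have h4 : L * ‖h‖ ^ 3 ≤ σ / 2 * ‖h‖ ^ 3 :=
    mul_le_mul_of_nonneg_right (by linarith) (by positivity)
  rw [mul_pow] at y2
  rw [mul_add]
  linarith
end
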